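/- arXiv:1907.13093 — 4 statements merged into one kernel-verified Lean document; each statement's English description precedes it below -/
import Mathlib

section
/- Lemma A3 (trace bound linking the least-squares quasi-Jacobian and the quasi-posterior variance, deterministic form): Let Θ ⊂ ℝ^d be compact with positive Lebesgue measure, ḡ : Θ → ℝ^m bounded measurable, and w : Θ → [0,∞) measurable with 0 < ∫_Θ w(θ)dθ < ∞ and w(θ) = 0 whenever ‖ḡ(θ)‖ > c, for a constant c > 0. Let π̂ := w/∫_Θ w, θ̄ := ∫_Θ θ dπ̂, Σ := ∫_Θ (θ−θ̄)(θ−θ̄)′dπ̂, and let (A,B) be any minimizer of (A,B) ↦ ∫_Θ ‖A + Bθ − ḡ(θ)‖²·w(θ)dθ over A ∈ ℝ^m, B ∈ ℝ^{m×d}. Then trace(B Σ B′) ≤ 12c², and consequently, with eigenvalues in increasing order, λ_j(B′B)·λ_{d+1−j}(Σ) ≤ 12c² for every j ∈ {1,…,d}. -/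
open Matrix MeasureTheory Set
open scoped Classical

/-- Euclidean norm of a vector in `ℝ^m`. -/
noncomputable def vnorm {m : ℕ} (x : Fin m → ℝ) : ℝ := Real.sqrt (∑ i, (x i) ^ 2)

/-- The eigenvalues of a real square matrix, sorted in increasing order
(junk value `0` if the matrix is not Hermitian/symmetric). -/
noncomputable def sortedEig {n : ℕ} (S : Matrix (Fin n) (Fin n) ℝ) : Fin n → ℝ :=
  if h : S.IsHermitian then h.eigenvalues ∘ ⇑(Tuple.sort h.eigenvalues) else 0

lemma vnorm_sq' {m : ℕ} (x : Fin m → ℝ) : vnorm x ^ 2 = ∑ i, (x i) ^ 2 :=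
  Real.sq_sqrt (Finset.sum_nonneg fun i _ => sq_nonneg _)

lemma abs_le_vnorm {m : ℕ} (x : Fin m → ℝ) (i : Fin m) : |x i| ≤ vnorm x := by
  unfold vnorm
  apply Real.abs_le_sqrt
  exact Finset.single_le_sum (f := fun i => (x i) ^ 2) (fun i _ => sq_nonneg _) (Finset.mem_univ i)

lemma ds_bound {d : ℕ} (p s : Fin d → ℝ) (hp : Monotone p) (hs : Monotone s)
    (hp0 : ∀ i, 0 ≤ p i) (hs0 : ∀ i, 0 ≤ s i) (M : Fin d → Fin d → ℝ)
    (hM : ∀ k l, 0 ≤ M k l) (hr : ∀ k, ∑ l, M k l = 1) (hcl : ∀ l, ∑ k, M k l = 1)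
    (j : Fin d) : p j * s (Fin.rev j) ≤ ∑ k, ∑ l, p k * s l * M k l := by
  have h1 : (1 : ℝ) ≤ ∑ k ∈ Finset.Ici j, ∑ l ∈ Finset.Ici (Fin.rev j), M k l := by
    have e1 : ∀ k, ∑ l ∈ Finset.Ici (Fin.rev j), M k l
        = 1 - ∑ l ∈ (Finset.Ici (Fin.rev j))ᶜ, M k l := by
      intro k
      rw [← hr k, ← Finset.sum_add_sum_compl (Finset.Ici (Fin.rev j))]
      ring
    have e2 : ∑ k ∈ Finset.Ici j, ∑ l ∈ (Finset.Ici (Fin.rev j))ᶜ, M k l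
        ≤ ((Finset.Ici (Fin.rev j))ᶜ.card : ℝ) := by
      rw [Finset.sum_comm]
      calc _ ≤ ∑ l ∈ (Finset.Ici (Fin.rev j))ᶜ, (1 : ℝ) := by
            apply Finset.sum_le_sum
            intro l _
            rw [← hcl l]
            exact Finset.sum_le_sum_of_subset_of_nonneg (Finset.subset_univ _)
              (fun i _ _ => hM i l)
        _ = _ := by simp
    simp only [e1, Finset.sum_sub_distrib]
    have hc1 : (Finset.Ici j).card = ((Finset.Ici (Fin.rev j))ᶜ).card + 1 := by
      rw [Finset.card_compl, Fin.card_Ici, Fin.card_Ici, Fintype.card_fin, Fin.val_rev]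
      have := j.2
      omega
    have : ∑ k ∈ Finset.Ici j, (1 : ℝ) = ((Finset.Ici (Fin.rev j))ᶜ.card : ℝ) + 1 := by
      rw [Finset.sum_const, hc1]; simp
    linarith
  have hps : 0 ≤ p j * s (Fin.rev j) := mul_nonneg (hp0 _) (hs0 _)
  have hnn : ∀ k l, 0 ≤ p k * s l * M k l := fun k l =>
    mul_nonneg (mul_nonneg (hp0 _) (hs0 _)) (hM _ _)
  calc p j * s (Fin.rev j)
      ≤ p j * s (Fin.rev j) * ∑ k ∈ Finset.Ici j, ∑ l ∈ Finset.Ici (Fin.rev j), M k l :=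
        le_mul_of_one_le_right hps h1
    _ = ∑ k ∈ Finset.Ici j, ∑ l ∈ Finset.Ici (Fin.rev j), p j * s (Fin.rev j) * M k l := by
        simp only [Finset.mul_sum]
    _ ≤ ∑ k ∈ Finset.Ici j, ∑ l ∈ Finset.Ici (Fin.rev j), p k * s l * M k l := by
        apply Finset.sum_le_sum; intro k hk
        apply Finset.sum_le_sum; intro l hl
        apply mul_le_mul_of_nonneg_right _ (hM k l)
        exact mul_le_mul (hp (Finset.mem_Ici.1 hk)) (hs (Finset.mem_Ici.1 hl)) (hs0 _) (hp0 _)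
    _ ≤ ∑ k ∈ Finset.Ici j, ∑ l, p k * s l * M k l := by
        apply Finset.sum_le_sum; intro k hk
        exact Finset.sum_le_sum_of_subset_of_nonneg (Finset.subset_univ _) (fun i _ _ => hnn k i)
    _ ≤ _ := Finset.sum_le_sum_of_subset_of_nonneg (Finset.subset_univ _)
        (fun i _ _ => Finset.sum_nonneg fun l _ => hnn i l)

lemma trace_eig {d : ℕ} (P S : Matrix (Fin d) (Fin d) ℝ) (hP : P.PosSemidef) (hS : S.PosSemidef)
    (j : Fin d) : sortedEig P j * sortedEig S (Fin.rev j) ≤ (P * S).trace := by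
  have hPh := hP.isHermitian
  have hSh := hS.isHermitian
  set p := hPh.eigenvalues with hp
  set s := hSh.eigenvalues with hs
  obtain ⟨V, hV1, hV2, hPV⟩ : ∃ V : Matrix (Fin d) (Fin d) ℝ, V * Vᵀ = 1 ∧ Vᵀ * V = 1 ∧
      P = V * diagonal p * Vᵀ := by
    refine ⟨hPh.eigenvectorUnitary, ?_, ?_, ?_⟩
    · simpa [star_eq_conjTranspose] using (Unitary.mul_star_self_of_mem hPh.eigenvectorUnitary.2)
    · simpa [star_eq_conjTranspose] using (Unitary.star_mul_self_of_mem hPh.eigenvectorUnitary.2)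
    · simpa [Unitary.conjStarAlgAut_apply, star_eq_conjTranspose, Function.comp_def] using hPh.spectral_theorem
  obtain ⟨U, hU1, hU2, hSU⟩ : ∃ V : Matrix (Fin d) (Fin d) ℝ, V * Vᵀ = 1 ∧ Vᵀ * V = 1 ∧
      S = V * diagonal s * Vᵀ := by
    refine ⟨hSh.eigenvectorUnitary, ?_, ?_, ?_⟩
    · simpa [star_eq_conjTranspose] using (Unitary.mul_star_self_of_mem hSh.eigenvectorUnitary.2)
    · simpa [star_eq_conjTranspose] using (Unitary.star_mul_self_of_mem hSh.eigenvectorUnitary.2)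
    · simpa [Unitary.conjStarAlgAut_apply, star_eq_conjTranspose, Function.comp_def] using hSh.spectral_theorem
  set W := Vᵀ * U with hW
  have hW1 : W * Wᵀ = 1 := by
    rw [hW, transpose_mul, transpose_transpose, Matrix.mul_assoc, ← Matrix.mul_assoc U, hU1,
      Matrix.one_mul, hV2]
  have hW2 : Wᵀ * W = 1 := by
    rw [hW, transpose_mul, transpose_transpose, Matrix.mul_assoc, ← Matrix.mul_assoc V, hV1,
      Matrix.one_mul, hU2]
  have htr : (P * S).trace = ∑ k, ∑ l, p k * s l * (W k l) ^ 2 := by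
    have : (P * S).trace = (diagonal p * (W * (diagonal s * Wᵀ))).trace := by
      rw [hPV, hSU, hW, transpose_mul, transpose_transpose]
      simp only [Matrix.mul_assoc]
      rw [Matrix.trace_mul_comm]
      simp only [Matrix.mul_assoc]
    rw [this]
    simp only [Matrix.trace, Matrix.diag, Matrix.diagonal_mul]
    apply Finset.sum_congr rfl; intro k _
    rw [Matrix.mul_apply, Finset.mul_sum]
    apply Finset.sum_congr rfl; intro l _
    rw [Matrix.diagonal_mul, transpose_apply]; ring
  have hr : ∀ k, ∑ l, (W k l) ^ 2 = 1 := by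
    intro k
    have := congrFun (congrFun hW1 k) k
    simpa [Matrix.mul_apply, sq] using this
  have hcl : ∀ l, ∑ k, (W k l) ^ 2 = 1 := by
    intro k
    have := congrFun (congrFun hW2 k) k
    simpa [Matrix.mul_apply, sq] using this
  have e1 : sortedEig P = p ∘ Tuple.sort p := dif_pos hPh
  have e2 : sortedEig S = s ∘ Tuple.sort s := dif_pos hSh
  rw [e1, e2, htr]
  have := ds_bound (p ∘ Tuple.sort p) (s ∘ Tuple.sort s) (Tuple.monotone_sort p)
    (Tuple.monotone_sort s) (fun i => hP.eigenvalues_nonneg _) (fun i => hS.eigenvalues_nonneg _)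
    (fun k l => (W (Tuple.sort p k) (Tuple.sort s l)) ^ 2) (fun _ _ => sq_nonneg _)
    (fun k => by
      rw [← hr (Tuple.sort p k)]
      exact Equiv.sum_comp (Tuple.sort s) (fun l => (W (Tuple.sort p k) l) ^ 2))
    (fun l => by
      rw [← hcl (Tuple.sort s l)]
      exact Equiv.sum_comp (Tuple.sort p) (fun k => (W k (Tuple.sort s l)) ^ 2)) j
  refine this.trans (le_of_eq ?_)
  rw [← Equiv.sum_comp (Tuple.sort p) (fun k => ∑ l, p k * s l * (W k l) ^ 2)]
  apply Finset.sum_congr rfl; intro k _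
  exact Equiv.sum_comp (Tuple.sort s) (fun l => p (Tuple.sort p k) * s l * (W (Tuple.sort p k) l) ^ 2)

/-- **Lemma A3 (deterministic form): trace bound linking the least-squares quasi-Jacobian
and the quasi-posterior variance.**  Let `Θ ⊂ ℝ^d` be compact with positive Lebesgue measure,
`ḡ : Θ → ℝ^m` bounded measurable, and `w ≥ 0` measurable with `0 < ∫_Θ w < ∞` and `w(θ) = 0`
whenever `‖ḡ(θ)‖ > c`.  With `π̂ := w/∫w`, `θ̄ := ∫ θ dπ̂`, `Σ := ∫ (θ−θ̄)(θ−θ̄)′ dπ̂`, any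
minimizer `(A,B)` of `∫_Θ ‖A + Bθ − ḡ(θ)‖² w(θ) dθ` satisfies `trace(B Σ B′) ≤ 12 c²` and
`λ_j(B′B)·λ_{d+1−j}(Σ) ≤ 12 c²` for every `j`. -/
theorem trace_bound_ls_quasi_jacobian {d m : ℕ}
    (Θ : Set (Fin d → ℝ)) (hΘc : IsCompact Θ) (hΘm : MeasurableSet Θ)
    (hΘpos : 0 < volume Θ)
    (gbar : (Fin d → ℝ) → (Fin m → ℝ)) (hgmeas : Measurable gbar)
    (Cg : ℝ) (hgbdd : ∀ θ ∈ Θ, vnorm (gbar θ) ≤ Cg)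
    (w : (Fin d → ℝ) → ℝ) (hwmeas : Measurable w) (hwnn : ∀ θ, 0 ≤ w θ)
    (hwint : IntegrableOn w Θ volume)
    (hwpos : 0 < ∫ θ in Θ, w θ)
    (c : ℝ) (hc : 0 < c)
    (hvanish : ∀ θ ∈ Θ, c < vnorm (gbar θ) → w θ = 0)
    (θbar : Fin d → ℝ) (hθbar : ∀ i, θbar i = (∫ θ in Θ, θ i * w θ) / ∫ θ in Θ, w θ)
    (Sig : Matrix (Fin d) (Fin d) ℝ)
    (hSig : ∀ i j, Sig i j =
      (∫ θ in Θ, (θ i - θbar i) * (θ j - θbar j) * w θ) / ∫ θ in Θ, w θ)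
    (A : Fin m → ℝ) (B : Matrix (Fin m) (Fin d) ℝ)
    (hmin : ∀ (A' : Fin m → ℝ) (B' : Matrix (Fin m) (Fin d) ℝ),
      (∫ θ in Θ, (vnorm (A + B.mulVec θ - gbar θ)) ^ 2 * w θ) ≤
      (∫ θ in Θ, (vnorm (A' + B'.mulVec θ - gbar θ)) ^ 2 * w θ)) :
    (B * Sig * Bᴴ).trace ≤ 12 * c ^ 2 ∧
    ∀ j : Fin d, sortedEig (Bᴴ * B) j * sortedEig Sig (Fin.rev j) ≤ 12 * c ^ 2 := by
  set I := ∫ θ in Θ, w θ with hI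
  have hcont : ∀ f : (Fin d → ℝ) → ℝ, Continuous f → IntegrableOn (fun θ => f θ * w θ) Θ volume :=
    fun f hf => IntegrableOn.continuousOn_mul hf.continuousOn hwint hΘc
  -- quadratic form
  have hquad : ∀ b : Fin d → ℝ, (∑ k, ∑ l, b k * Sig k l * b l) * I
      = ∫ θ in Θ, (∑ k, b k * (θ k - θbar k)) ^ 2 * w θ := by
    intro b
    have e : ∀ θ : Fin d → ℝ, (∑ k, b k * (θ k - θbar k)) ^ 2 * w θ
        = ∑ k, ∑ l, b k * b l * ((θ k - θbar k) * (θ l - θbar l) * w θ) := by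
      intro θ
      rw [sq, Finset.sum_mul_sum, Finset.sum_mul]
      apply Finset.sum_congr rfl; intro k _
      rw [Finset.sum_mul]
      apply Finset.sum_congr rfl; intro l _
      ring
    have hi : ∀ k l, IntegrableOn
        (fun θ : Fin d → ℝ => b k * b l * ((θ k - θbar k) * (θ l - θbar l) * w θ)) Θ volume :=
      fun k l => (hcont (fun θ => (θ k - θbar k) * (θ l - θbar l)) (by fun_prop)).const_mul _
    simp only [e]
    rw [integral_finsetSum _ (fun k _ => integrable_finsetSum _ (fun l _ => hi k l)),
      Finset.sum_mul]
    apply Finset.sum_congr rfl; intro k _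
    rw [integral_finsetSum _ (fun l _ => hi k l), Finset.sum_mul]
    apply Finset.sum_congr rfl; intro l _
    rw [integral_const_mul, hSig]
    field_simp
  have hSpsd : Sig.PosSemidef := by
    refine Matrix.PosSemidef.of_dotProduct_mulVec_nonneg ?_ ?_
    · ext i j
      simp only [conjTranspose_apply, star_trivial, hSig]
      congr 2
      ext θ; ring
    · intro x
      have h1 : star x ⬝ᵥ Sig *ᵥ x = ∑ k, ∑ l, x k * Sig k l * x l := by
        simp [dotProduct, mulVec, Finset.mul_sum, mul_assoc]
      rw [h1]
      have h2 := hquad x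
      have h3 : 0 ≤ ∫ θ in Θ, (∑ k, x k * (θ k - θbar k)) ^ 2 * w θ :=
        integral_nonneg fun θ => mul_nonneg (sq_nonneg _) (hwnn θ)
      rw [← h2] at h3
      exact nonneg_of_mul_nonneg_left h3 hwpos
  have hmean : ∀ k, ∫ θ in Θ, (θ k - θbar k) * w θ = 0 := by
    intro k
    have i1 : IntegrableOn (fun θ : Fin d → ℝ => θ k * w θ) Θ volume :=
      hcont (fun θ => θ k) (by fun_prop)
    simp only [sub_mul]
    rw [integral_sub i1 (hwint.const_mul _), integral_const_mul, hθbar]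
    rw [← hI]; field_simp; ring
  -- the centred linear map
  set u : (Fin d → ℝ) → Fin m → ℝ := fun θ i => ∑ k, B i k * (θ k - θbar k) with hu
  set a : Fin m → ℝ := A + B.mulVec θbar with ha
  have hucont : ∀ i, Continuous fun θ => u θ i := by
    intro i; simp only [hu]; fun_prop
  have htrI : (B * Sig * Bᴴ).trace * I = ∫ θ in Θ, (∑ i, (u θ i) ^ 2) * w θ := by
    have e : (B * Sig * Bᴴ).trace = ∑ i, ∑ k, ∑ l, B i k * Sig k l * B i l := by
      simp only [Matrix.trace, Matrix.diag, Matrix.mul_apply, conjTranspose_apply, star_trivial,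
        Finset.sum_mul]
      apply Finset.sum_congr rfl; intro i _
      rw [Finset.sum_comm]
    rw [e, Finset.sum_mul]
    simp only [Finset.sum_mul _ _ (w _)]
    rw [integral_finsetSum _ (fun i _ => hcont (fun θ => (u θ i) ^ 2) ((hucont i).pow 2))]
    exact Finset.sum_congr rfl fun i _ => hquad (B i)
  have huI : ∀ i, ∫ θ in Θ, u θ i * w θ = 0 := by
    intro i
    have e : ∀ θ, u θ i * w θ = ∑ k, B i k * ((θ k - θbar k) * w θ) := by
      intro θ
      simp only [hu, Finset.sum_mul, mul_assoc]
    simp only [e]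
    rw [integral_finsetSum _ (fun k _ =>
      (hcont (fun θ => θ k - θbar k) (by fun_prop)).const_mul _)]
    simp only [integral_const_mul, hmean, mul_zero, Finset.sum_const_zero]
  have hauI : ∫ θ in Θ, (∑ i, a i * u θ i) * w θ = 0 := by
    have e : ∀ θ, (∑ i, a i * u θ i) * w θ = ∑ i, a i * (u θ i * w θ) := by
      intro θ
      simp only [Finset.sum_mul, mul_assoc]
    simp only [e]
    rw [integral_finsetSum _ (fun i _ => (hcont _ (hucont i)).const_mul _)]
    simp only [integral_const_mul, huI, mul_zero, Finset.sum_const_zero]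
  have hgi : ∀ i, Measurable fun θ => gbar θ i := fun i => (measurable_pi_apply i).comp hgmeas
  have hgb : ∀ i, ∀ᵐ θ ∂(volume.restrict Θ), ‖gbar θ i‖ ≤ Cg := by
    intro i
    filter_upwards [ae_restrict_mem hΘm] with θ hθ
    exact (abs_le_vnorm _ i).trans (hgbdd θ hθ)
  have hgw : ∀ i, IntegrableOn (fun θ => gbar θ i * w θ) Θ volume := fun i =>
    Integrable.bdd_mul hwint (hgi i).aestronglyMeasurable (hgb i)
  have hggw : ∀ i, IntegrableOn (fun θ => gbar θ i * (gbar θ i * w θ)) Θ volume := fun i =>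
    Integrable.bdd_mul (hgw i) (hgi i).aestronglyMeasurable (hgb i)
  have hint : ∀ f : (Fin d → ℝ) → Fin m → ℝ, (∀ i, Continuous fun θ => f θ i) →
      IntegrableOn (fun θ => (vnorm (f θ - gbar θ)) ^ 2 * w θ) Θ volume := by
    intro f hf
    have e : (fun θ => (vnorm (f θ - gbar θ)) ^ 2 * w θ) = fun θ => ∑ i,
        ((f θ i ^ 2 * w θ - (2 * f θ i) * (gbar θ i * w θ)) + gbar θ i * (gbar θ i * w θ)) := by
      ext θ
      rw [vnorm_sq', Finset.sum_mul]
      apply Finset.sum_congr rfl; intro i _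
      simp only [Pi.sub_apply]; ring
    rw [e]
    refine integrable_finsetSum _ fun i _ => Integrable.add (Integrable.sub ?_ ?_) (hggw i)
    · exact hcont (fun θ => f θ i ^ 2) ((hf i).pow 2)
    · exact IntegrableOn.continuousOn_mul (continuous_const.mul (hf i)).continuousOn (hgw i) hΘc
  have hm := hmin a 0
  have e1 : ∀ θ, A + B.mulVec θ = a + u θ := by
    intro θ; ext i
    simp only [ha, hu, Pi.add_apply, mulVec, dotProduct, mul_sub, Finset.sum_sub_distrib]
    ring
  simp only [e1, zero_mulVec, add_zero] at hm
  have i1 := hint (fun θ => a + u θ) (fun i => continuous_const.add (hucont i))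
  have i2 := hint (fun θ => a) (fun i => continuous_const)
  have i3 : IntegrableOn (fun θ => (∑ i, (u θ i) ^ 2) * w θ) Θ volume :=
    hcont (fun θ => ∑ i, (u θ i) ^ 2) (continuous_finsetSum _ fun i _ => (hucont i).pow 2)
  have i4 : IntegrableOn (fun θ => (∑ i, a i * u θ i) * w θ) Θ volume :=
    hcont (fun θ => ∑ i, a i * u θ i)
      (continuous_finsetSum _ fun i _ => continuous_const.mul (hucont i))
  have i5 : IntegrableOn (fun θ => (1 / 2 : ℝ) * ((∑ i, (u θ i) ^ 2) * w θ)
        + 2 * ((∑ i, a i * u θ i) * w θ)) Θ volume := (i3.const_mul _).add (i4.const_mul _)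
  have key : ∫ θ in Θ, ((1 / 2 : ℝ) * ((∑ i, (u θ i) ^ 2) * w θ)
        + 2 * ((∑ i, a i * u θ i) * w θ) - 2 * c ^ 2 * w θ)
      ≤ ∫ θ in Θ, ((vnorm (a + u θ - gbar θ)) ^ 2 * w θ - (vnorm (a - gbar θ)) ^ 2 * w θ) := by
    refine setIntegral_mono_on (((i3.const_mul _).add (i4.const_mul _)).sub (hwint.const_mul _))
      (i1.sub i2) hΘm ?_
    intro θ hθ
    by_cases hw : w θ = 0
    · simp [hw]
    have hg : vnorm (gbar θ) ≤ c := by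
      by_contra h
      exact hw (hvanish θ hθ (not_le.1 h))
    have hg2 : ∑ i, (gbar θ i) ^ 2 ≤ c ^ 2 := by
      rw [← vnorm_sq']
      exact pow_le_pow_left₀ (Real.sqrt_nonneg _) hg 2
    have h1 : (1 / 2 : ℝ) * (∑ i, (u θ i) ^ 2) + 2 * (∑ i, a i * u θ i)
        - 2 * ∑ i, (gbar θ i) ^ 2 ≤ (vnorm (a + u θ - gbar θ)) ^ 2 - (vnorm (a - gbar θ)) ^ 2 := by
      rw [vnorm_sq', vnorm_sq', Finset.mul_sum, Finset.mul_sum, Finset.mul_sum,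
        ← Finset.sum_add_distrib, ← Finset.sum_sub_distrib, ← Finset.sum_sub_distrib]
      apply Finset.sum_le_sum; intro i _
      simp only [Pi.sub_apply, Pi.add_apply]
      nlinarith [sq_nonneg (u θ i - 2 * gbar θ i)]
    have h2 := mul_le_mul_of_nonneg_right
      (h1.trans' (sub_le_sub_left (mul_le_mul_of_nonneg_left hg2 zero_le_two) _)) (hwnn θ)
    linarith
  rw [integral_sub i1 i2, integral_sub i5 (hwint.const_mul _),
    integral_add (i3.const_mul _) (i4.const_mul _), integral_const_mul, integral_const_mul,
    integral_const_mul, hauI, ← htrI, ← hI] at key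
  have htr : (B * Sig * Bᴴ).trace ≤ 12 * c ^ 2 := by
    have : (B * Sig * Bᴴ).trace * I ≤ (12 * c ^ 2) * I := by
      have := mul_nonneg (sq_nonneg c) hwpos.le
      linarith
    exact le_of_mul_le_mul_right this hwpos
  refine ⟨htr, fun j => ?_⟩
  refine (trace_eig _ _ (Matrix.posSemidef_conjTranspose_mul_self B) hSpsd j).trans ?_
  rwa [Matrix.mul_assoc, Matrix.trace_mul_comm]
end

section
/- Lemma A4 (lower bound on the top covariance eigenvalues from mass on separated balls): Let π be a Borel probability measure on ℝ^d with finite second moments, mean β̄ := ∫β dπ and covariance Σ := ∫(β−β̄)(β−β̄)′dπ. Write d = d₁ + d₂ and points as β = (β₁,β₂) ∈ ℝ^{d₁}×ℝ^{d₂}. Suppose there are pairs (β^j, β̃^j) ∈ ℝ^d × ℝ^d, j = 1,…,d₂, with β^j − β̃^j = (0, v₂^j) where v₂¹,…,v₂^{d₂} ∈ ℝ^{d₂} are linearly independent; set V₂ := (v₂¹ ⋯ v₂^{d₂}). Let ε > 0 satisfy ε² ≤ λ_min(V₂V₂′)/d₂, and suppose every closed ball of radius ε/6 centered at one of the 2d₂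 points β^j, β̃^j has π-measure at least η > 0. Then α′Σα ≥ η·ε²/9 for every unit vector α of the form α = (0,α₂), and consequently, with eigenvalues in increasing order, λ_j(Σ) ≥ η·ε²/9 for every j ≥ d − d₂ + 1. -/
open Matrix MeasureTheory Set
open scoped Classical

/-- The smallest eigenvalue of a real symmetric matrix, via the Rayleigh quotient. -/
noncomputable def eigMin {d : ℕ} (S : Matrix (Fin d) (Fin d) ℝ) : ℝ :=
  ⨅ v : {v : Fin d → ℝ // ∑ i, (v i) ^ 2 = 1}, v.1 ⬝ᵥ S.mulVec v.1

lemma aux_dot_le {n : ℕ} (a x : Fin n → ℝ) (ha : vnorm a = 1) (r : ℝ) (hx : vnorm x ≤ r) :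
    |a ⬝ᵥ x| ≤ r := by
  have h := Finset.sum_mul_sq_le_sq_mul_sq Finset.univ a x
  have ha' : ∑ i, a i ^ 2 = 1 := by
    unfold vnorm at ha
    have := Real.sqrt_eq_one.mp ha
    exact this
  rw [ha', one_mul] at h
  refine le_trans ?_ hx
  unfold vnorm
  exact Real.abs_le_sqrt h

lemma aux_quad {n : ℕ} (π : Measure (Fin n → ℝ)) [IsProbabilityMeasure π]
    (hmom1 : ∀ i, Integrable (fun β => β i) π)
    (hmom2 : ∀ i j, Integrable (fun β => β i * β j) π)
    (b : Fin n → ℝ) (Sig : Matrix (Fin n) (Fin n) ℝ)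
    (hSig : ∀ i j, Sig i j = ∫ β, (β i - b i) * (β j - b j) ∂π) (α : Fin n → ℝ) :
    Integrable (fun β => (α ⬝ᵥ (β - b)) ^ 2) π ∧
      α ⬝ᵥ Sig.mulVec α = ∫ β, (α ⬝ᵥ (β - b)) ^ 2 ∂π := by
  have hint : ∀ i j, Integrable (fun β : Fin n → ℝ => (β i - b i) * (β j - b j)) π := by
    intro i j
    have := (((hmom2 i j).sub ((hmom1 j).const_mul (b i))).sub ((hmom1 i).const_mul (b j))).add
      (integrable_const (b i * b j))
    refine this.congr (Filter.Eventually.of_forall fun β => ?_)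
    simp only [Pi.add_apply, Pi.sub_apply]
    ring
  have heq : (fun β : Fin n → ℝ => (α ⬝ᵥ (β - b)) ^ 2) =
      fun β => ∑ i, ∑ j, (α i * α j) * ((β i - b i) * (β j - b j)) := by
    funext β
    simp only [dotProduct, sq, Finset.sum_mul_sum, Pi.sub_apply]
    refine Finset.sum_congr rfl fun i _ => Finset.sum_congr rfl fun j _ => ?_
    ring
  rw [heq]
  refine ⟨integrable_finsetSum _ fun i _ => integrable_finsetSum _ fun j _ =>
    (hint i j).const_mul _, ?_⟩
  rw [integral_finsetSum _ fun i _ => integrable_finsetSum _ fun j _ =>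
    (hint i j).const_mul _]
  simp only [dotProduct, mulVec, Finset.mul_sum]
  refine Finset.sum_congr rfl fun i _ => ?_
  rw [integral_finsetSum _ fun j _ => (hint i j).const_mul _]
  refine Finset.sum_congr rfl fun j _ => ?_
  rw [integral_const_mul, hSig]
  ring

lemma aux_VV {d2 : ℕ} (V2 : Matrix (Fin d2) (Fin d2) ℝ) (a : Fin d2 → ℝ) :
    a ⬝ᵥ (V2 * V2ᴴ).mulVec a = ∑ j, (∑ i, a i * V2 i j) ^ 2 := by
  rw [← mulVec_mulVec, dotProduct_mulVec]
  simp only [dotProduct, vecMul, mulVec, conjTranspose_apply, star_trivial, sq]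
  refine Finset.sum_congr rfl fun j _ => ?_
  congr 1
  exact Finset.sum_congr rfl fun i _ => mul_comm _ _

lemma aux_dir {d2 : ℕ} (V2 : Matrix (Fin d2) (Fin d2) ℝ) (ε : ℝ)
    (hε2 : ε ^ 2 ≤ eigMin (V2 * V2ᴴ) / d2) (a : Fin d2 → ℝ) (ha : ∑ i, a i ^ 2 = 1) :
    ∃ j, ε ^ 2 ≤ (∑ i, a i * V2 i j) ^ 2 := by
  have h1 : eigMin (V2 * V2ᴴ) ≤ a ⬝ᵥ (V2 * V2ᴴ).mulVec a := by
    unfold eigMin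
    refine ciInf_le (f := fun v : {v : Fin d2 → ℝ // ∑ i, (v i) ^ 2 = 1} =>
      v.1 ⬝ᵥ (V2 * V2ᴴ).mulVec v.1) ⟨0, ?_⟩ ⟨a, ha⟩
    rintro _ ⟨v, rfl⟩
    simp only
    rw [aux_VV]
    positivity
  rw [aux_VV] at h1
  have hd : 0 < d2 := by
    rcases Nat.eq_zero_or_pos d2 with h | h
    · subst h; simp at ha
    · exact h
  have hd' : (0 : ℝ) < d2 := by exact_mod_cast hd
  rw [le_div_iff₀ hd'] at hε2
  by_contra! hcon
  have : ∑ j, (∑ i, a i * V2 i j) ^ 2 < ∑ j : Fin d2, ε ^ 2 :=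
    Finset.sum_lt_sum_of_nonempty ⟨⟨0, hd⟩, Finset.mem_univ _⟩ fun j _ => hcon j
  simp at this
  linarith

lemma aux_eig {d1 d2 : ℕ} (S : Matrix (Fin (d1 + d2)) (Fin (d1 + d2)) ℝ) (hS : S.IsHermitian)
    (c : ℝ) (h : ∀ α : Fin (d1 + d2) → ℝ, (∀ i : Fin d1, α (Fin.castAdd d2 i) = 0) →
        vnorm α = 1 → c ≤ α ⬝ᵥ S.mulVec α) (j : Fin (d1 + d2)) (hj : d1 ≤ (j : ℕ)) :
    c ≤ sortedEig S j := by
  unfold sortedEig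
  rw [dif_pos hS]
  set σ := Tuple.sort hS.eigenvalues with hσ
  have hmono : Monotone (hS.eigenvalues ∘ σ) := Tuple.monotone_sort _
  by_contra! hlt
  set U : Matrix (Fin (d1 + d2)) (Fin (d1 + d2)) ℝ :=
    (hS.eigenvectorUnitary).1 with hU
  have hUU : Uᵀ * U = 1 := by
    have := Unitary.coe_star_mul_self hS.eigenvectorUnitary
    simpa [star_eq_conjTranspose] using this
  have hSU : S * U = U * diagonal hS.eigenvalues := by
    have := hS.spectral_theorem
    rw [Unitary.conjStarAlgAut_apply] at this
    conv_lhs => rw [this]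
    rw [mul_assoc, Unitary.coe_star_mul_self, mul_one]
    rfl
  let L : (Fin (d1 + d2) → ℝ) →ₗ[ℝ] ((Fin d1 → ℝ) × ({k : Fin (d1 + d2) // j < k} → ℝ)) :=
    LinearMap.prod ((LinearMap.funLeft ℝ ℝ (Fin.castAdd d2)).comp U.mulVecLin)
      (LinearMap.funLeft ℝ ℝ (fun k : {k : Fin (d1 + d2) // j < k} => σ k.1))
  have hker : LinearMap.ker L ≠ ⊥ := by
    apply LinearMap.ker_ne_bot_of_finrank_lt
    have : Fintype.card {k : Fin (d1 + d2) // j < k} = d1 + d2 - 1 - j := by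
      rw [Fintype.card_subtype, ← Fin.card_Ioi j]
      congr 1
      ext; simp
    rw [Module.finrank_prod, Module.finrank_fintype_fun_eq_card, Module.finrank_fintype_fun_eq_card,
      Module.finrank_fintype_fun_eq_card, this]
    simp
    omega
  obtain ⟨e, heL, he0⟩ := Submodule.exists_mem_ne_zero_of_ne_bot hker
  have heL' := LinearMap.mem_ker.mp heL
  have h1 : ∀ i : Fin d1, (U *ᵥ e) (Fin.castAdd d2 i) = 0 := fun i =>
    congrFun (congrArg Prod.fst heL') i
  have h2 : ∀ k, j < k → e (σ k) = 0 := fun k hk =>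
    congrFun (congrArg Prod.snd heL') ⟨k, hk⟩
  have hpos : 0 < ∑ i, e i ^ 2 := by
    obtain ⟨i, hi⟩ := Function.ne_iff.mp he0
    exact Finset.sum_pos' (fun i _ => sq_nonneg _) ⟨i, Finset.mem_univ _, by
      have : e i ≠ 0 := hi
      positivity⟩
  have hnorm : ∀ x : Fin (d1 + d2) → ℝ, (U *ᵥ e) ⬝ᵥ (U *ᵥ x) = e ⬝ᵥ x := by
    intro x
    rw [dotProduct_mulVec, ← mulVec_transpose, mulVec_mulVec, hUU, one_mulVec]
  have hq : (U *ᵥ e) ⬝ᵥ (S *ᵥ (U *ᵥ e)) = ∑ i, hS.eigenvalues i * e i ^ 2 := by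
    rw [mulVec_mulVec, hSU, ← mulVec_mulVec, hnorm]
    simp only [dotProduct, mulVec_diagonal]
    refine Finset.sum_congr rfl fun i _ => ?_
    ring
  have hn : ∑ i, (U *ᵥ e) i ^ 2 = ∑ i, e i ^ 2 := by
    have := hnorm e
    simpa [dotProduct, sq] using this
  have hup : ∑ i, hS.eigenvalues i * e i ^ 2 ≤ (hS.eigenvalues (σ j)) * ∑ i, e i ^ 2 := by
    rw [Finset.mul_sum, ← Equiv.sum_comp σ, ← Equiv.sum_comp σ (fun i => _ * e i ^ 2)]
    refine Finset.sum_le_sum fun k _ => ?_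
    rcases le_or_gt k j with hk | hk
    · exact mul_le_mul_of_nonneg_right (hmono hk) (sq_nonneg _)
    · simp [h2 k hk]
  set s := Real.sqrt (∑ i, e i ^ 2) with hs
  have hs0 : 0 < s := Real.sqrt_pos.mpr hpos
  have hss : s ^ 2 = ∑ i, e i ^ 2 := Real.sq_sqrt hpos.le
  have := h (s⁻¹ • (U *ᵥ e)) (fun i => by simp [h1 i]) (by
    unfold vnorm
    rw [Real.sqrt_eq_one]
    simp only [Pi.smul_apply, smul_eq_mul, mul_pow]
    rw [← Finset.mul_sum, hn, ← hss]
    field_simp)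
  rw [mulVec_smul, smul_dotProduct, dotProduct_smul, hq, smul_eq_mul, smul_eq_mul] at this
  have h3 : c * s ^ 2 ≤ ∑ i, hS.eigenvalues i * e i ^ 2 := by
    calc c * s ^ 2 ≤ (s⁻¹ * (s⁻¹ * ∑ i, hS.eigenvalues i * e i ^ 2)) * s ^ 2 := by gcongr
      _ = _ := by field_simp
  have h4 : hS.eigenvalues (σ j) < c := hlt
  rw [hss] at h3
  nlinarith

/-- **Lemma A4: lower bound on the top covariance eigenvalues from mass on separated balls.**
Let `π` be a Borel probability measure on `ℝ^d`, `d = d₁ + d₂`, with finite second moments,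
mean `β̄` and covariance `Σ`.  Suppose there are pairs `(β^j, β̃^j)`, `j = 1, …, d₂`, with
`β^j − β̃^j = (0, v₂^j)` where the `v₂^j ∈ ℝ^{d₂}` are linearly independent, that
`ε > 0` satisfies `ε² ≤ λ_min(V₂V₂′)/d₂`, and that every closed ball of radius `ε/6`
centered at one of the `2d₂` points has `π`-measure at least `η > 0`.  Then
`α′Σα ≥ η·ε²/9` for every unit vector `α = (0, α₂)`, and `λ_j(Σ) ≥ η·ε²/9` for every
`j ≥ d − d₂ + 1` (1-based), i.e. for every 0-based index `j` with `d₁ ≤ j`. -/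
theorem covariance_lower_bound_from_separated_mass {d1 d2 : ℕ}
    (π : Measure (Fin (d1 + d2) → ℝ)) [IsProbabilityMeasure π]
    (hmom1 : ∀ i, Integrable (fun β => β i) π)
    (hmom2 : ∀ i j, Integrable (fun β => β i * β j) π)
    (βbar : Fin (d1 + d2) → ℝ) (hβbar : ∀ i, βbar i = ∫ β, β i ∂π)
    (Sig : Matrix (Fin (d1 + d2)) (Fin (d1 + d2)) ℝ)
    (hSig : ∀ i j, Sig i j = ∫ β, (β i - βbar i) * (β j - βbar j) ∂π)
    (βp βtp : Fin d2 → (Fin (d1 + d2) → ℝ))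
    (v2 : Fin d2 → (Fin d2 → ℝ))
    (hdiff : ∀ j, βp j - βtp j = Fin.append (0 : Fin d1 → ℝ) (v2 j))
    (hv2 : LinearIndependent ℝ v2)
    (V2 : Matrix (Fin d2) (Fin d2) ℝ) (hV2 : ∀ i j, V2 i j = v2 j i)
    (ε : ℝ) (hε : 0 < ε) (hε2 : ε ^ 2 ≤ eigMin (V2 * V2ᴴ) / d2)
    (η : ℝ) (hη : 0 < η)
    (hmass : ∀ p ∈ (Set.range βp ∪ Set.range βtp),
      ENNReal.ofReal η ≤ π {β | vnorm (β - p) ≤ ε / 6}) :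
    (∀ α : Fin (d1 + d2) → ℝ, (∀ i : Fin d1, α (Fin.castAdd d2 i) = 0) →
        vnorm α = 1 → η * ε ^ 2 / 9 ≤ α ⬝ᵥ Sig.mulVec α) ∧
    (∀ j : Fin (d1 + d2), d1 ≤ (j : ℕ) → η * ε ^ 2 / 9 ≤ sortedEig Sig j) := by
  have key : ∀ α : Fin (d1 + d2) → ℝ, (∀ i : Fin d1, α (Fin.castAdd d2 i) = 0) →
        vnorm α = 1 → η * ε ^ 2 / 9 ≤ α ⬝ᵥ Sig.mulVec α := by
    intro α hα0 hα
    obtain ⟨hint, hq⟩ := aux_quad π hmom1 hmom2 βbar Sig hSig α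
    have hsum : ∑ i, α i ^ 2 = 1 := Real.sqrt_eq_one.mp hα
    rw [Fin.sum_univ_add] at hsum
    simp only [hα0] at hsum
    obtain ⟨j, hj⟩ := aux_dir V2 ε hε2 (fun i => α (Fin.natAdd d1 i)) (by simpa using hsum)
    have hdot : α ⬝ᵥ (βp j - βtp j) = ∑ i, α (Fin.natAdd d1 i) * V2 i j := by
      rw [hdiff, dotProduct, Fin.sum_univ_add]
      simp [hV2]
    rw [← hdot] at hj
    have habs : ε ≤ |α ⬝ᵥ (βp j - βtp j)| := by
      have := sq_le_sq.mp hj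
      rwa [abs_of_pos hε] at this
    have hex : ∃ p ∈ (Set.range βp ∪ Set.range βtp), ε / 2 ≤ |α ⬝ᵥ (p - βbar)| := by
      by_contra! hcon
      have ha := hcon (βp j) (Or.inl ⟨j, rfl⟩)
      have hb := hcon (βtp j) (Or.inr ⟨j, rfl⟩)
      have he : α ⬝ᵥ (βp j - βtp j) = α ⬝ᵥ (βp j - βbar) - α ⬝ᵥ (βtp j - βbar) := by
        rw [← dotProduct_sub]; congr 1; abel
      have := abs_sub (α ⬝ᵥ (βp j - βbar)) (α ⬝ᵥ (βtp j - βbar))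
      rw [he] at habs
      linarith
    obtain ⟨p, hp, hpe⟩ := hex
    have hsub : {β | vnorm (β - p) ≤ ε / 6} ⊆ {β | (ε / 3) ^ 2 ≤ (α ⬝ᵥ (β - βbar)) ^ 2} := by
      intro β hβ
      have h1 := aux_dot_le α (β - p) hα _ hβ
      have he : α ⬝ᵥ (p - βbar) = α ⬝ᵥ (β - βbar) - α ⬝ᵥ (β - p) := by
        rw [← dotProduct_sub]; congr 1; abel
      have := abs_sub (α ⬝ᵥ (β - βbar)) (α ⬝ᵥ (β - p))
      rw [he] at hpe
      change (ε / 3) ^ 2 ≤ (α ⬝ᵥ (β - βbar)) ^ 2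
      refine sq_le_sq.mpr ?_
      rw [abs_of_pos (by positivity)]
      linarith
    have hm : η ≤ π.real {β | (ε / 3) ^ 2 ≤ (α ⬝ᵥ (β - βbar)) ^ 2} := by
      rw [Measure.real, ← ENNReal.ofReal_le_iff_le_toReal (measure_ne_top _ _)]
      exact (hmass p hp).trans (measure_mono hsub)
    have hmk := mul_meas_ge_le_integral_of_nonneg
      (μ := π) (f := fun β => (α ⬝ᵥ (β - βbar)) ^ 2)
      (Filter.Eventually.of_forall fun β => sq_nonneg (α ⬝ᵥ (β - βbar))) hint ((ε / 3) ^ 2)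
    rw [hq]
    refine le_trans ?_ hmk
    calc η * ε ^ 2 / 9 = (ε / 3) ^ 2 * η := by ring
      _ ≤ _ := by gcongr
  refine ⟨key, fun j hj => aux_eig Sig ?_ _ key j hj⟩
  ext i k
  simp only [conjTranspose_apply, star_trivial, hSig]
  congr 1
  funext β
  ring
end

section
/- Deterministic core of the sup-norm approximation (from the proof of Theorem 2): Let Θ ⊂ ℝ^d be compact, ḡ : Θ → ℝ^m bounded, W : Θ → symmetric positive definite m×m matrices with λ_min(W(θ)) ≥ λ̲ > 0 for all θ, and K : [0,∞) → [0,∞) with K(x) = 0 for x ≥ 1, K̄ := sup_{x∈[0,1]} K(x) < ∞ and K̲ := inf_{x∈[0,1/2]} K(x) > 0. Fix κ > 0 and let (A,B) ∈ ℝ^m × ℝ^{m×d} be a minimizer of (A,B) ↦ sup_{θ∈Θ} ‖A + Bθ − ḡ(θ)‖·K(‖ḡ(θ)‖_{W(θ)}/κ). If θ¹, θ² ∈ Θ satisfy ‖ḡ(θ^i)‖_{W(θ^i)} ≤ κ/2 for i = 1,2, then ‖B(θ¹ − θ²)‖ ≤ (1 + 2K̄/K̲)·λ̲^{−1/2}·κ.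 -/
open Matrix Set

/-- The `W`-weighted norm `‖x‖_W = (x′ W x)^{1/2}`. -/
noncomputable def wnorm {m : ℕ} (W : Matrix (Fin m) (Fin m) ℝ) (x : Fin m → ℝ) : ℝ :=
  Real.sqrt (x ⬝ᵥ W.mulVec x)

theorem vnorm_eq {m : ℕ} (x : Fin m → ℝ) : vnorm x = ‖WithLp.toLp 2 x‖ := by
  simp [vnorm, EuclideanSpace.norm_eq]

theorem vnorm_add_le {m : ℕ} (x y : Fin m → ℝ) : vnorm (x + y) ≤ vnorm x + vnorm y := by
  simp only [vnorm_eq, WithLp.toLp_add]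
  exact norm_add_le _ _

theorem vnorm_sub_le {m : ℕ} (x y : Fin m → ℝ) : vnorm (x - y) ≤ vnorm x + vnorm y := by
  simp only [vnorm_eq, WithLp.toLp_sub]
  exact norm_sub_le _ _

theorem vnorm_nonneg' {m : ℕ} (x : Fin m → ℝ) : 0 ≤ vnorm x := Real.sqrt_nonneg _

theorem vnorm_neg' {m : ℕ} (x : Fin m → ℝ) : vnorm (-x) = vnorm x := by
  simp [vnorm]

/-- **Deterministic core of the sup-norm approximation** (from the proof of Theorem 2).
Let `Θ ⊂ ℝ^d` be compact, `ḡ : Θ → ℝ^m` bounded, `W(θ)` symmetric positive definite with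
`λ_min(W(θ)) ≥ λ̲ > 0`, and `K` a kernel with `K(x) = 0` for `x ≥ 1`,
`K̄ = sup_{[0,1]} K < ∞` and `K̲ = inf_{[0,1/2]} K > 0`.  If `(A, B)` minimizes the sup-norm
loss `sup_{θ∈Θ} ‖A + Bθ − ḡ(θ)‖·K(‖ḡ(θ)‖_{W(θ)}/κ)` and `θ¹, θ² ∈ Θ` satisfy
`‖ḡ(θ^i)‖_{W(θ^i)} ≤ κ/2`, then `‖B(θ¹ − θ²)‖ ≤ (1 + 2K̄/K̲)·λ̲^{−1/2}·κ`. -/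
theorem supnorm_approx_contraction {d m : ℕ}
    (Θ : Set (Fin d → ℝ)) (hΘ : IsCompact Θ)
    (gbar : (Fin d → ℝ) → (Fin m → ℝ))
    (Cg : ℝ) (hgbdd : ∀ θ ∈ Θ, vnorm (gbar θ) ≤ Cg)
    (W : (Fin d → ℝ) → Matrix (Fin m) (Fin m) ℝ)
    (hWsym : ∀ θ, (W θ).IsSymm)
    (lamlo : ℝ) (hlamlo : 0 < lamlo)
    (hWev : ∀ θ x, lamlo * (∑ i, (x i) ^ 2) ≤ x ⬝ᵥ (W θ).mulVec x)
    (K : ℝ → ℝ) (hKnn : ∀ x, 0 ≤ K x) (hKzero : ∀ x, 1 ≤ x → K x = 0)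
    (Kbar Klow : ℝ)
    (hKbar : Kbar = sSup (K '' Icc (0 : ℝ) 1)) (hKbarfin : BddAbove (K '' Icc (0 : ℝ) 1))
    (hKlow : Klow = sInf (K '' Icc (0 : ℝ) (1 / 2))) (hKlowpos : 0 < Klow)
    (κ : ℝ) (hκ : 0 < κ)
    (A : Fin m → ℝ) (B : Matrix (Fin m) (Fin d) ℝ)
    (hmin : ∀ (A' : Fin m → ℝ) (B' : Matrix (Fin m) (Fin d) ℝ),
      (⨆ θ : Θ, vnorm (A + B.mulVec θ.1 - gbar θ.1) * K (wnorm (W θ.1) (gbar θ.1) / κ)) ≤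
      (⨆ θ : Θ, vnorm (A' + B'.mulVec θ.1 - gbar θ.1) * K (wnorm (W θ.1) (gbar θ.1) / κ)))
    (θ1 θ2 : Fin d → ℝ) (hθ1 : θ1 ∈ Θ) (hθ2 : θ2 ∈ Θ)
    (hg1 : wnorm (W θ1) (gbar θ1) ≤ κ / 2) (hg2 : wnorm (W θ2) (gbar θ2) ≤ κ / 2) :
    vnorm (B.mulVec (θ1 - θ2)) ≤ (1 + 2 * Kbar / Klow) * κ / Real.sqrt lamlo := by
  have hs : 0 < Real.sqrt lamlo := Real.sqrt_pos.2 hlamlo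
  have hvw : ∀ θ, Real.sqrt lamlo * vnorm (gbar θ) ≤ wnorm (W θ) (gbar θ) := by
    intro θ
    unfold vnorm wnorm
    rw [← Real.sqrt_mul hlamlo.le]
    exact Real.sqrt_le_sqrt (hWev θ _)
  have hw0 : ∀ θ, 0 ≤ wnorm (W θ) (gbar θ) / κ :=
    fun θ => div_nonneg (Real.sqrt_nonneg _) hκ.le
  have hKb1 : ∀ x, 0 ≤ x → x ≤ 1 → K x ≤ Kbar := by
    intro x h0 h1
    rw [hKbar]
    exact le_csSup hKbarfin ⟨x, ⟨h0, h1⟩, rfl⟩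
  have hKbar0 : 0 ≤ Kbar := (hKnn 0).trans (hKb1 0 le_rfl zero_le_one)
  have hKb : ∀ x, 0 ≤ x → K x ≤ Kbar := by
    intro x h0
    rcases le_total x 1 with h | h
    · exact hKb1 x h0 h
    · rw [hKzero x h]; exact hKbar0
  have hKl : ∀ x, 0 ≤ x → x ≤ 1 / 2 → Klow ≤ K x := by
    intro x h0 h1
    rw [hKlow]
    refine csInf_le ⟨0, ?_⟩ ⟨x, ⟨h0, h1⟩, rfl⟩
    rintro _ ⟨y, _, rfl⟩
    exact hKnn y
  have hbdd : BddAbove (range fun θ : Θ =>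
      vnorm (A + B.mulVec θ.1 - gbar θ.1) * K (wnorm (W θ.1) (gbar θ.1) / κ)) := by
    have hc : Continuous fun θ : Fin d → ℝ => vnorm (A + B.mulVec θ) := by
      unfold vnorm
      fun_prop
    obtain ⟨C, hC⟩ := (hΘ.image hc).bddAbove
    refine ⟨(C + Cg) * Kbar, ?_⟩
    rintro _ ⟨θ, rfl⟩
    have h1 : vnorm (A + B.mulVec θ.1) ≤ C := hC ⟨θ.1, θ.2, rfl⟩
    have h2 := hgbdd θ.1 θ.2
    have h3 := vnorm_sub_le (A + B.mulVec θ.1) (gbar θ.1)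
    have h4 := vnorm_nonneg' (A + B.mulVec θ.1 - gbar θ.1)
    exact mul_le_mul (by linarith) (hKb _ (hw0 _)) (hKnn _) (by linarith)
  have : Nonempty Θ := ⟨⟨θ1, hθ1⟩⟩
  have hup : (⨆ θ : Θ, vnorm (A + B.mulVec θ.1 - gbar θ.1) * K (wnorm (W θ.1) (gbar θ.1) / κ))
      ≤ κ / Real.sqrt lamlo * Kbar := by
    refine (hmin 0 0).trans (ciSup_le ?_)
    intro θ
    rw [Matrix.zero_mulVec, add_zero, zero_sub, vnorm_neg']
    rcases le_total 1 (wnorm (W θ.1) (gbar θ.1) / κ) with h | h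
    · rw [hKzero _ h, mul_zero]; positivity
    · refine mul_le_mul ?_ (hKb _ (hw0 _)) (hKnn _) (by positivity)
      rw [le_div_iff₀ hs]
      rw [div_le_one hκ] at h
      have := hvw θ.1
      linarith
  have key : ∀ θ, θ ∈ Θ → wnorm (W θ) (gbar θ) ≤ κ / 2 →
      vnorm (A + B.mulVec θ) ≤ κ / Real.sqrt lamlo * Kbar / Klow + κ / 2 / Real.sqrt lamlo := by
    intro θ hθ hg
    have h1 := (le_ciSup hbdd ⟨θ, hθ⟩).trans hup
    have h2 : Klow ≤ K (wnorm (W θ) (gbar θ) / κ) := by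
      refine hKl _ (hw0 _) ?_
      rw [div_le_iff₀ hκ]; linarith
    have h3 : vnorm (A + B.mulVec θ - gbar θ) ≤ κ / Real.sqrt lamlo * Kbar / Klow := by
      rw [le_div_iff₀ hKlowpos]
      exact (mul_le_mul_of_nonneg_left h2 (vnorm_nonneg' _)).trans h1
    have h4 : vnorm (gbar θ) ≤ κ / 2 / Real.sqrt lamlo := by
      rw [le_div_iff₀ hs]
      have := hvw θ
      linarith
    have h5 := vnorm_add_le (A + B.mulVec θ - gbar θ) (gbar θ)
    rw [sub_add_cancel] at h5
    linarith
  have e : B.mulVec (θ1 - θ2) = (A + B.mulVec θ1) - (A + B.mulVec θ2) := by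
    rw [Matrix.mulVec_sub]; abel
  rw [e]
  refine (vnorm_sub_le _ _).trans ((add_le_add (key θ1 hθ1 hg1) (key θ2 hθ2 hg2)).trans ?_)
  apply le_of_eq
  field_simp
  ring
end

section
/- Small singular values from contracted directions (used in the proofs of Theorems 2 and 3): Let B be a real m×d matrix and v¹,…,v^k ∈ ℝ^d linearly independent vectors with ‖Bv^j‖ ≤ c for every j = 1,…,k, and let V := (v¹ ⋯ v^k) ∈ ℝ^{d×k}. Then, with eigenvalues in increasing order, Σ_{j=1}^k λ_j(B′B) ≤ k·c²/λ_min(V′V). -/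
open Matrix
open scoped Classical

lemma aux_sum {k e : ℕ} (hk : 0 < k) (a q : Fin (k + e) → ℝ) (ha : Monotone a)
    (q0 : ∀ i, 0 ≤ q i) (q1 : ∀ i, q i ≤ 1) (hq : ∑ i, q i = k) :
    ∑ j : Fin k, a (Fin.castAdd e j) ≤ ∑ i, a i * q i := by
  set t := a (Fin.castAdd e ⟨k - 1, by omega⟩) with ht
  rw [Fin.sum_univ_add] at hq ⊢
  have h1 : ∑ j : Fin k, (a (Fin.castAdd e j) + t * q (Fin.castAdd e j) - t)
      ≤ ∑ j : Fin k, a (Fin.castAdd e j) * q (Fin.castAdd e j) := by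
    apply Finset.sum_le_sum
    intro j _
    have h2 : a (Fin.castAdd e j) ≤ t := by
      apply ha
      rw [Fin.le_def]
      simp
      omega
    nlinarith [q1 (Fin.castAdd e j)]
  have h3 : ∑ j : Fin e, t * q (Fin.natAdd k j)
      ≤ ∑ j : Fin e, a (Fin.natAdd k j) * q (Fin.natAdd k j) := by
    apply Finset.sum_le_sum
    intro j _
    have h2 : t ≤ a (Fin.natAdd k j) := by
      apply ha
      rw [Fin.le_def]
      simp
      omega
    exact mul_le_mul_of_nonneg_right h2 (q0 _)
  rw [Finset.sum_sub_distrib, Finset.sum_add_distrib, ← Finset.mul_sum] at h1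
  rw [← Finset.mul_sum] at h3
  simp at h1
  have h4 := congrArg (fun x => t * x) hq
  simp only [mul_add] at h4
  linarith

lemma aux_q {d k : ℕ} (W : Matrix (Fin d) (Fin k) ℝ) (μ : ℝ) (hμ : 0 < μ)
    (hG : ∀ z : Fin k → ℝ, μ * (z ⬝ᵥ z) ≤ z ⬝ᵥ (Wᵀ * W) *ᵥ z) :
    ∃ q : Fin d → ℝ, (∀ i, 0 ≤ q i) ∧ (∀ i, q i ≤ 1) ∧ ∑ i, q i = k ∧
      ∀ i, μ * q i ≤ ∑ j, W i j ^ 2 := by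
  set G := Wᵀ * W with hGd
  have hu : IsUnit G := by
    rw [← Matrix.mulVec_injective_iff_isUnit]
    rw [← Matrix.coe_mulVecLin, injective_iff_map_eq_zero]
    intro z hz
    have h := hG z
    rw [Matrix.mulVecLin_apply] at hz
    rw [hz, dotProduct_zero] at h
    have h0 : 0 ≤ z ⬝ᵥ z := Finset.sum_nonneg fun i _ => mul_self_nonneg _
    have : z ⬝ᵥ z = 0 := by nlinarith
    exact dotProduct_self_eq_zero.1 this
  have hdet : IsUnit G.det := (Matrix.isUnit_iff_isUnit_det _).1 hu
  have hGt : Gᵀ = G := by simp [hGd]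
  set P := W * G⁻¹ * Wᵀ with hP
  have hPt : Pᵀ = P := by
    simp [hP, Matrix.transpose_nonsing_inv, hGt, Matrix.mul_assoc]
  have hPP : P * P = P := by
    calc P * P = W * G⁻¹ * (Wᵀ * W) * G⁻¹ * Wᵀ := by simp only [hP, Matrix.mul_assoc]
      _ = P := by rw [← hGd, Matrix.nonsing_inv_mul_cancel_right _ _ hdet]
  have hdiag : ∀ i, P i i = ∑ j, P i j ^ 2 := by
    intro i
    conv_lhs => rw [← hPP, Matrix.mul_apply]
    refine Finset.sum_congr rfl fun j _ => ?_
    rw [sq, show P j i = P i j from congrFun (congrFun hPt i) j]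
  refine ⟨fun i => P i i, fun i => ?_, fun i => ?_, ?_, fun i => ?_⟩
  · dsimp only
    rw [hdiag]; positivity
  · have : P i i ^ 2 ≤ P i i := by
      conv_rhs => rw [hdiag]
      exact Finset.single_le_sum (f := fun j => P i j ^ 2) (fun _ _ => sq_nonneg _)
        (Finset.mem_univ i)
    dsimp only
    nlinarith
  · change P.trace = k
    rw [hP, Matrix.mul_assoc, Matrix.trace_mul_comm, Matrix.mul_assoc, ← hGd,
      Matrix.nonsing_inv_mul _ hdet]
    simp
  · set y : Fin k → ℝ := W i with hy
    set z := G⁻¹ *ᵥ y with hz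
    have hyz : G *ᵥ z = y := by
      rw [hz, Matrix.mulVec_mulVec, Matrix.mul_nonsing_inv _ hdet, Matrix.one_mulVec]
    have hPi : P i i = z ⬝ᵥ y := by
      rw [hP, Matrix.mul_assoc, Matrix.mul_apply, dotProduct_comm]
      simp only [dotProduct, hz, hy]
      refine Finset.sum_congr rfl fun j _ => ?_
      rfl
    have h1 := hG z
    rw [hyz] at h1
    have hcs : (z ⬝ᵥ y) ^ 2 ≤ (∑ j, z j ^ 2) * ∑ j, y j ^ 2 :=
      Finset.sum_mul_sq_le_sq_mul_sq _ _ _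
    have hzz : z ⬝ᵥ z = ∑ j, z j ^ 2 := by simp [dotProduct, sq]
    rw [hzz] at h1
    have hy0 : 0 ≤ ∑ j, y j ^ 2 := by positivity
    have hz0 : 0 ≤ ∑ j, z j ^ 2 := by positivity
    dsimp only
    rw [hPi]
    rcases le_or_gt (z ⬝ᵥ y) 0 with h | h
    · nlinarith
    · have : (μ * (z ⬝ᵥ y)) * (z ⬝ᵥ y) ≤ (∑ j, y j ^ 2) * (z ⬝ᵥ y) := by
        nlinarith [mul_le_mul_of_nonneg_left hcs hμ.le, mul_le_mul_of_nonneg_right h1 hy0]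
      exact le_of_mul_le_mul_right this h

lemma aux_min {d k : ℕ} (hk : 0 < k) (V : Matrix (Fin d) (Fin k) ℝ)
    (hinj : Function.Injective V.mulVec) :
    0 < eigMin (Vᴴ * V) ∧ ∀ z : Fin k → ℝ, eigMin (Vᴴ * V) * (z ⬝ᵥ z) ≤ z ⬝ᵥ (Vᵀ * V) *ᵥ z := by
  have hq : ∀ z : Fin k → ℝ, z ⬝ᵥ (Vᴴ * V) *ᵥ z = (V *ᵥ z) ⬝ᵥ (V *ᵥ z) := by
    intro z
    rw [Matrix.conjTranspose_eq_transpose_of_trivial, ← Matrix.mulVec_mulVec,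
      Matrix.dotProduct_mulVec, Matrix.vecMul_transpose]
  have hnn : ∀ z : Fin k → ℝ, 0 ≤ z ⬝ᵥ (Vᴴ * V) *ᵥ z := by
    intro z; rw [hq]; exact Finset.sum_nonneg fun i _ => mul_self_nonneg _
  have hcont : Continuous fun z : Fin k → ℝ => z ⬝ᵥ (Vᴴ * V) *ᵥ z := by
    fun_prop
  have hcomp : IsCompact {v : Fin k → ℝ | ∑ i, (v i) ^ 2 = 1} := by
    apply Metric.isCompact_of_isClosed_isBounded
    · exact isClosed_eq (by fun_prop) (by fun_prop)
    · refine (Metric.isBounded_closedBall (x := (0 : Fin k → ℝ)) (r := 1)).subset ?_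
      intro x hx
      rw [mem_closedBall_zero_iff, pi_norm_le_iff_of_nonneg zero_le_one]
      intro i
      have h1 : x i ^ 2 ≤ ∑ i, x i ^ 2 :=
        Finset.single_le_sum (f := fun j => x j ^ 2) (fun _ _ => sq_nonneg _) (Finset.mem_univ i)
      rw [Real.norm_eq_abs, ← sq_le_one_iff_abs_le_one]
      exact h1.trans_eq hx
  have hne : {v : Fin k → ℝ | ∑ i, (v i) ^ 2 = 1}.Nonempty :=
    ⟨Pi.single ⟨0, hk⟩ 1, by simp [Pi.single_apply]⟩
  obtain ⟨x, hx, hmin⟩ := hcomp.exists_isMinOn hne hcont.continuousOn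
  have hxpos : 0 < x ⬝ᵥ (Vᴴ * V) *ᵥ x := by
    refine lt_of_le_of_ne (hnn x) fun h => ?_
    rw [hq] at h
    have h2 := dotProduct_self_eq_zero.1 h.symm
    have : x = 0 := hinj (by simpa using h2)
    subst this
    simp at hx
  haveI : Nonempty {v : Fin k → ℝ // ∑ i, (v i) ^ 2 = 1} := ⟨⟨x, hx⟩⟩
  constructor
  · exact lt_of_lt_of_le hxpos (le_ciInf fun v => hmin v.2)
  · intro z
    rw [← Matrix.conjTranspose_eq_transpose_of_trivial]
    by_cases hz : z ⬝ᵥ z = 0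
    · rw [hz, mul_zero]; exact hnn z
    have hz0 : 0 ≤ z ⬝ᵥ z := Finset.sum_nonneg fun i _ => mul_self_nonneg _
    have hzp : 0 < z ⬝ᵥ z := lt_of_le_of_ne hz0 (Ne.symm hz)
    set s := Real.sqrt (z ⬝ᵥ z) with hs
    have hs2 : s ^ 2 = z ⬝ᵥ z := Real.sq_sqrt hz0
    have hsp : 0 < s := Real.sqrt_pos.2 hzp
    have hzs : ∑ i, (s⁻¹ • z) i ^ 2 = 1 := by
      have : ∑ i, (s⁻¹ • z) i ^ 2 = (s ^ 2)⁻¹ * (z ⬝ᵥ z) := by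
        simp only [dotProduct, Finset.mul_sum, Pi.smul_apply, smul_eq_mul]
        refine Finset.sum_congr rfl fun i _ => ?_
        ring
      rw [this, hs2, inv_mul_cancel₀ hz]
    have hle : eigMin (Vᴴ * V) ≤ (s⁻¹ • z) ⬝ᵥ (Vᴴ * V) *ᵥ (s⁻¹ • z) :=
      ciInf_le (f := fun v : {v : Fin k → ℝ // ∑ i, (v i) ^ 2 = 1} => v.1 ⬝ᵥ (Vᴴ * V).mulVec v.1)
        ⟨0, by rintro _ ⟨w, rfl⟩; exact hnn _⟩ ⟨s⁻¹ • z, hzs⟩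
    rw [Matrix.mulVec_smul, dotProduct_smul, smul_dotProduct, smul_eq_mul, smul_eq_mul] at hle
    rw [← hs2]
    calc _ ≤ (s⁻¹ * (s⁻¹ * (z ⬝ᵥ (Vᴴ * V) *ᵥ z))) * s ^ 2 :=
          mul_le_mul_of_nonneg_right hle (sq_nonneg s)
      _ = _ := by field_simp

/-- **Small singular values from contracted directions.**
Let `B` be a real `m × d` matrix and `v¹, …, v^k ∈ ℝ^d` linearly independent vectors with
`‖B v^j‖ ≤ c` for every `j`, and let `V := (v¹ ⋯ v^k)`.  Then, with eigenvalues in increasing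
order, `∑_{j=1}^k λ_j(B′B) ≤ k · c² / λ_min(V′V)`. -/
theorem sum_smallest_eigenvalues_le {m d k : ℕ} (hkd : k ≤ d)
    (B : Matrix (Fin m) (Fin d) ℝ) (c : ℝ)
    (v : Fin k → (Fin d → ℝ))
    (hv : LinearIndependent ℝ v)
    (hBv : ∀ j : Fin k, vnorm (B.mulVec (v j)) ≤ c)
    (V : Matrix (Fin d) (Fin k) ℝ) (hV : ∀ i j, V i j = v j i) :
    ∑ j : Fin k, sortedEig (Bᴴ * B) (Fin.castLE hkd j) ≤ k * c ^ 2 / eigMin (Vᴴ * V) := by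
  rcases Nat.eq_zero_or_pos k with rfl | hk
  · simp
  have hcol : V.col = v := by
    funext j i; exact hV i j
  have hinj : Function.Injective V.mulVec := by
    rw [Matrix.mulVec_injective_iff, hcol]; exact hv
  obtain ⟨hμ, hμG⟩ := aux_min hk V hinj
  have hS : (Bᴴ * B).IsHermitian := Matrix.isHermitian_conjTranspose_mul_self B
  have hpsd : (Bᴴ * B).PosSemidef := Matrix.posSemidef_conjTranspose_mul_self B
  set μ := eigMin (Vᴴ * V) with hμd
  set l := hS.eigenvalues with hl
  have hl0 : ∀ i, 0 ≤ l i := hpsd.eigenvalues_nonneg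
  set U : Matrix (Fin d) (Fin d) ℝ := (hS.eigenvectorUnitary : Matrix (Fin d) (Fin d) ℝ) with hU
  have hUU : U * Uᵀ = 1 := by
    have := Unitary.mul_star_self_of_mem hS.eigenvectorUnitary.2
    rw [Matrix.star_eq_conjTranspose] at this
    rw [← Matrix.conjTranspose_eq_transpose_of_trivial U]
    exact this
  have hspec : Bᴴ * B = U * Matrix.diagonal l * Uᵀ := by
    have := hS.spectral_theorem
    rw [Unitary.conjStarAlgAut_apply, Matrix.star_eq_conjTranspose,
      Matrix.conjTranspose_eq_transpose_of_trivial U] at this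
    exact this
  set W := Uᵀ * V with hW
  have hWW : Wᵀ * W = Vᵀ * V := by
    rw [hW, Matrix.transpose_mul, Matrix.transpose_transpose, Matrix.mul_assoc,
      ← Matrix.mul_assoc U, hUU, Matrix.one_mul]
  obtain ⟨q, q0, q1, hqs, hqW⟩ := aux_q W μ hμ (by rw [hWW]; exact hμG)
  -- trace identity
  have htr1 : ((B * V)ᵀ * (B * V)).trace ≤ k * c ^ 2 := by
    have : ((B * V)ᵀ * (B * V)).trace = ∑ j : Fin k, ∑ i, (B *ᵥ v j) i ^ 2 := by
      simp only [Matrix.trace, Matrix.diag, Matrix.mul_apply, Matrix.transpose_apply,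
        Matrix.mulVec, dotProduct, hV, sq]
    rw [this]
    calc _ ≤ ∑ j : Fin k, c ^ 2 := by
          apply Finset.sum_le_sum
          intro j _
          exact (Real.sqrt_le_left ((Real.sqrt_nonneg _).trans (hBv j))).1 (hBv j)
      _ = _ := by simp
  have htr2 : ((B * V)ᵀ * (B * V)).trace = ∑ i, l i * ∑ j, W i j ^ 2 := by
    have h1 : (B * V)ᵀ * (B * V) = Wᵀ * (Matrix.diagonal l * W) := by
      calc (B * V)ᵀ * (B * V) = Vᵀ * (Bᴴ * B) * V := by
            rw [Matrix.conjTranspose_eq_transpose_of_trivial, Matrix.transpose_mul]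
            simp only [Matrix.mul_assoc]
        _ = _ := by
            rw [hspec, hW, Matrix.transpose_mul, Matrix.transpose_transpose]
            simp only [Matrix.mul_assoc]
    rw [h1, Matrix.trace_mul_comm, Matrix.trace]
    refine Finset.sum_congr rfl fun i _ => ?_
    rw [Matrix.diag_apply, Matrix.mul_assoc, Matrix.diagonal_mul, Matrix.mul_apply]
    simp [sq]
  have hsort : sortedEig (Bᴴ * B) = l ∘ Tuple.sort l := by
    rw [sortedEig, dif_pos hS]
  rw [hsort, le_div_iff₀ hμ]
  have hky : ∑ j : Fin k, (l ∘ Tuple.sort l) (Fin.castLE hkd j) ≤ ∑ i, l i * q i := by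
    rw [← Equiv.sum_comp (Tuple.sort l) (fun i => l i * q i)]
    have hmono := Tuple.monotone_sort l
    have hqs' : ∑ i, q (Tuple.sort l i) = k := by rw [Equiv.sum_comp]; exact hqs
    have gen : ∀ (d' : ℕ) (h : k ≤ d') (a q : Fin d' → ℝ), Monotone a → (∀ i, 0 ≤ q i) →
        (∀ i, q i ≤ 1) → ∑ i, q i = k → ∑ j : Fin k, a (Fin.castLE h j) ≤ ∑ i, a i * q i := by
      intro d' h a q ha h0 h1 h2
      obtain ⟨e, rfl⟩ := Nat.exists_eq_add_of_le h
      exact aux_sum hk a q ha h0 h1 h2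
    exact gen d hkd _ (fun i => q (Tuple.sort l i)) hmono (fun _ => q0 _) (fun _ => q1 _) hqs'
  calc _ ≤ (∑ i, l i * q i) * μ := mul_le_mul_of_nonneg_right hky hμ.le
    _ = ∑ i, l i * (μ * q i) := by
        rw [Finset.sum_mul]; exact Finset.sum_congr rfl fun i _ => by ring
    _ ≤ ∑ i, l i * ∑ j, W i j ^ 2 :=
        Finset.sum_le_sum fun i _ => mul_le_mul_of_nonneg_left (hqW i) (hl0 i)
    _ ≤ _ := htr2 ▸ htr1
end
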